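/- arXiv:1405.3414 — 7 statements merged into one kernel-verified Lean document; each statement's English description precedes it below -/
import Mathlib

section
/- Let m₁, m₂ be integers with 0 ≤ m₁ ≤ m₂ and let Λ₁, Λ₂ be vertices of G with d := d(Λ₁,Λ₂). Assume m₁ + m₂ ≡ d (mod 2) and d + m₁ ≤ m₂ (so that the ball B(Λ₁,m₁) is contained in B(Λ₂,m₂)). Then mult(m₂,Λ₂,Λ₁) + Σ_{Λ ∈ B(Λ₁,m₁)} mult(m₁,Λ₁,Λ)·I(m₂,Λ₂,Λ) = (m₁ + m₂ − d)/2 − p·(p^{m₁} − 1)/(p − 1). -/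
open SimpleGraph

/-- The multiplicity `mult(m, Λ₀, Λ)` of the vertical component `ℙ_Λ` in the local
Kudla–Rapoport divisor with `ord_p(b,b) = m` and central lattice `Λ₀`. -/
noncomputable def multKR {V : Type*} (G : SimpleGraph V) (m : ℕ) (Λ₀ Λ : V) : ℤ :=
  if G.dist Λ Λ₀ ≤ m then
    if G.dist Λ Λ₀ % 2 = m % 2 then ((m : ℤ) - (G.dist Λ Λ₀ : ℤ)) / 2
    else ((m : ℤ) - (G.dist Λ Λ₀ : ℤ) + 1) / 2
  else 0

/-- The intersection number `I(m, Λ₀, Λ) = ⟨ℙ_Λ, Z(b)⟩`. -/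
noncomputable def inumKR {V : Type*} (G : SimpleGraph V) (p m : ℕ) (Λ₀ Λ : V) : ℤ :=
  if G.dist Λ Λ₀ ≤ m then
    if G.dist Λ Λ₀ % 2 = m % 2 then 1 else -(p : ℤ)
  else 0

namespace SimpleGraph

variable {V : Type*} {G : SimpleGraph V}

/-- Every vertex of a tree other than the root `u` has a unique neighbor closer to `u`. -/
lemma IsTree.existsUnique_adj_dist_add_one (hG : G.IsTree) {u v : V} (hv : G.dist v u ≠ 0) :
    ∃! w, G.Adj v w ∧ G.dist w u + 1 = G.dist v u := by
  obtain ⟨q, hq⟩ := hG.connected.exists_walk_length_eq_dist v u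
  cases q with
  | nil => simp at hv
  | @cons _ w _ h q =>
    refine ⟨w, ⟨h, ?_⟩, ?_⟩
    · have h1 := dist_le q
      have h2 := h.diff_dist_adj (u := u)
      rw [Walk.length_cons] at hq
      simp only [dist_comm (u := u)] at h2
      omega
    · rintro w' ⟨h', hw'⟩
      obtain ⟨q', hq'⟩ := hG.connected.exists_walk_length_eq_dist w' u
      have hp := Walk.isPath_of_length_eq_dist _ hq
      have hp' := Walk.isPath_of_length_eq_dist (Walk.cons h' q')
        (by rw [Walk.length_cons, hq', hw'])
      have := congrArg Walk.snd ((hG.existsUnique_path v u).unique hp' hp)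
      simpa using this

/-- The number of vertices at distance `k` from a given vertex of the `(p + 1)`-regular tree. -/
def regularTreeSphereCard (p : ℕ) : ℕ → ℕ
  | 0 => 1
  | k + 1 => (p + 1) * p ^ k

lemma IsTree.exists_finset_sphere (hG : G.IsTree) {p : ℕ}
    (hdeg : ∀ v : V, (G.neighborSet v).ncard = p + 1) (u : V) (k : ℕ) :
    ∃ S : Finset V, (∀ v, v ∈ S ↔ G.dist v u = k) ∧ S.card = regularTreeSphereCard p k := by
  classical
  have hfin (v : V) : (G.neighborSet v).Finite :=
    Set.finite_of_ncard_ne_zero (by rw [hdeg]; omega)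
  have hN (v : V) : (hfin v).toFinset.card = p + 1 :=
    (Set.ncard_eq_toFinset_card _ (hfin v)).symm.trans (hdeg v)
  induction k with
  | zero => exact ⟨{u}, by simp [hG.connected.dist_eq_zero_iff], by simp [regularTreeSphereCard]⟩
  | succ k ih =>
    obtain ⟨S, hS, hcard⟩ := ih
    refine ⟨S.biUnion fun v ↦ {w ∈ (hfin v).toFinset | G.dist w u = k + 1}, fun w ↦ ?_, ?_⟩
    · simp only [Finset.mem_biUnion, Finset.mem_filter, Set.Finite.mem_toFinset, mem_neighborSet]
      refine ⟨fun ⟨v, _, _, hw⟩ ↦ hw, fun hw ↦ ?_⟩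
      obtain ⟨v, ⟨hv, hvd⟩, -⟩ := hG.existsUnique_adj_dist_add_one (u := u) (v := w) (by omega)
      exact ⟨v, (hS v).2 (by omega), hv.symm, hw⟩
    · rw [Finset.card_biUnion]
      · cases k with
        | zero =>
          have hSu : S = {u} := by
            ext v
            simp [hS, hG.connected.dist_eq_zero_iff]
          rw [hSu, Finset.sum_singleton, Finset.filter_true_of_mem, hN]
          · simp [regularTreeSphereCard]
          · intro w hw
            rw [Set.Finite.mem_toFinset, mem_neighborSet] at hw
            simpa [dist_eq_one_iff_adj] using hw.symm
        | succ k =>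
          rw [Finset.sum_const_nat (m := p), hcard]
          · simp [regularTreeSphereCard, pow_succ, mul_assoc]
          · intro v hv
            rw [hS] at hv
            obtain ⟨w, ⟨hw, hwd⟩, huniq⟩ :=
              hG.existsUnique_adj_dist_add_one (u := u) (v := v) (by omega)
            have : {x ∈ (hfin v).toFinset | G.dist x u = k + 1 + 1} =
                (hfin v).toFinset.erase w := by
              ext x
              simp only [Finset.mem_filter, Finset.mem_erase, Set.Finite.mem_toFinset,
                mem_neighborSet]
              constructor
              · rintro ⟨hx, hxd⟩
                refine ⟨?_, hx⟩
                rintro rfl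
                omega
              · rintro ⟨hne, hx⟩
                refine ⟨hx, ?_⟩
                have h := hG.dist_eq_dist_add_one_of_adj u hx
                simp only [dist_comm (u := u)] at h
                rcases h with h | h
                · exact absurd (huniq x ⟨hx, h.symm⟩) hne
                · omega
            rw [this, Finset.card_erase_of_mem (by simpa using hw), hN, Nat.add_sub_cancel]
      · intro v hv v' hv' hne
        rw [Function.onFun, Finset.disjoint_left]
        intro w hw hw'
        simp only [Finset.mem_filter, Set.Finite.mem_toFinset, mem_neighborSet] at hw hw'
        have h1 := (hS v).1 hv
        have h2 := (hS v').1 hv'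
        exact hne ((hG.existsUnique_adj_dist_add_one (u := u) (v := w) (by omega)).unique
          ⟨hw.1.symm, by omega⟩ ⟨hw'.1.symm, by omega⟩)

/-- Summing a radial function over a ball of the `(p + 1)`-regular tree. -/
lemma IsTree.finsum_mem_ball_dist (hG : G.IsTree) {p : ℕ}
    (hdeg : ∀ v : V, (G.neighborSet v).ncard = p + 1) (u : V) (m : ℕ) (f : ℕ → ℤ) :
    ∑ᶠ v ∈ {v : V | G.dist v u ≤ m}, f (G.dist v u) =
      ∑ k ∈ Finset.range (m + 1), (regularTreeSphereCard p k : ℤ) * f k := by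
  classical
  choose S hS hcard using hG.exists_finset_sphere hdeg u
  have hball : {v : V | G.dist v u ≤ m} = ((Finset.range (m + 1)).biUnion S : Finset V) := by
    ext v
    simp [hS]
  rw [hball, finsum_mem_coe_finset, Finset.sum_biUnion]
  · refine Finset.sum_congr rfl fun k _ ↦ ?_
    rw [← hcard, ← nsmul_eq_mul]
    exact Finset.sum_eq_card_nsmul fun v hv ↦ by rw [(hS k v).1 hv]
  · intro i _ j _ hij
    rw [Function.onFun, Finset.disjoint_left]
    intro v hi hj
    exact hij (((hS i v).1 hi).symm.trans ((hS j v).1 hj))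

lemma IsTree.dist_mod_two (hG : G.IsTree) (u v w : V) :
    G.dist u w % 2 = (G.dist u v + G.dist v w) % 2 := by
  obtain ⟨q, hq⟩ := hG.connected.exists_walk_length_eq_dist v u
  rw [dist_comm (u := u) (v := v), ← hq]
  clear hq
  induction q with
  | nil => simp
  | cons h q ih =>
    have := hG.dist_eq_dist_add_one_of_adj w h
    simp only [dist_comm (u := w)] at this
    rw [Walk.length_cons]
    omega

end SimpleGraph

/-- The multiplicity `multKR` as a function of the distance to the center. -/
def radialMult (m k : ℕ) : ℤ :=
  if k ≤ m then if k % 2 = m % 2 then ((m : ℤ) - k) / 2 else ((m : ℤ) - k + 1) / 2 else 0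

/-- The values of `inumKR` well inside the ball, as a function of the distance to the center. -/
def radialSign (p m k : ℕ) : ℤ := if k % 2 = m % 2 then 1 else -(p : ℤ)

lemma radialSign_add_two (p m k : ℕ) : radialSign p (m + 2) k = radialSign p m k := by
  simp [radialSign]

lemma radialMult_add_two {m k : ℕ} (hk : k < m + 2) :
    radialMult (m + 2) k = radialMult m k + 1 := by
  unfold radialMult
  split_ifs <;> push_cast <;> omega

lemma sum_sphereCard_mul_radialSign (p m : ℕ) :
    ∑ k ∈ Finset.range (m + 2), (regularTreeSphereCard p k : ℤ) * radialSign p m k =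
      1 - (p : ℤ) ^ (m + 1) * (p + 1) := by
  induction m using Nat.twoStepInduction with
  | zero => simp [Finset.sum_range_succ, regularTreeSphereCard, radialSign]; ring
  | one => simp [Finset.sum_range_succ, regularTreeSphereCard, radialSign]; ring
  | more m ih _ =>
    rw [Finset.sum_range_succ, Finset.sum_range_succ]
    simp only [radialSign_add_two, ih]
    simp [regularTreeSphereCard, radialSign, show (m + 2 + 1) % 2 ≠ m % 2 by omega]
    ring

lemma sum_sphereCard_mul_radialMult_mul_radialSign (p m : ℕ) :
    ∑ k ∈ Finset.range (m + 1),
      (regularTreeSphereCard p k : ℤ) * (radialMult m k * radialSign p m k) =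
      (m : ℤ) / 2 - p * ∑ i ∈ Finset.range m, (p : ℤ) ^ i := by
  induction m using Nat.twoStepInduction with
  | zero => simp [radialMult]
  | one => simp [Finset.sum_range_succ, radialMult, radialSign, regularTreeSphereCard]
  | more m ih _ =>
    have hlast : radialMult (m + 2) (m + 2) = 0 := by simp [radialMult]
    have hmid : radialMult m (m + 1) = 0 := by simp [radialMult]
    have hstep : ∀ k ∈ Finset.range (m + 2),
        (regularTreeSphereCard p k : ℤ) * (radialMult (m + 2) k * radialSign p (m + 2) k) =
          (regularTreeSphereCard p k : ℤ) * (radialMult m k * radialSign p m k) +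
            (regularTreeSphereCard p k : ℤ) * radialSign p m k := fun k hk ↦ by
      rw [radialMult_add_two (Finset.mem_range.1 hk), radialSign_add_two]
      ring
    rw [Finset.sum_range_succ, hlast, Finset.sum_congr rfl hstep, Finset.sum_add_distrib,
      sum_sphereCard_mul_radialSign, Finset.sum_range_succ, hmid, ih,
      Finset.sum_range_succ _ (m + 1), Finset.sum_range_succ _ m]
    have : ((m + 2 : ℕ) : ℤ) / 2 = (m : ℤ) / 2 + 1 := by push_cast; omega
    rw [this]
    ring

theorem statement0 {V : Type*} (p : ℕ) (hp : 2 ≤ p) (G : SimpleGraph V)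
    (htree : G.IsTree) (hdeg : ∀ v : V, (G.neighborSet v).ncard = p + 1)
    (m₁ m₂ : ℕ) (hm : m₁ ≤ m₂) (Λ₁ Λ₂ : V)
    (hpar : (m₁ + m₂) % 2 = G.dist Λ₁ Λ₂ % 2)
    (hball : G.dist Λ₁ Λ₂ + m₁ ≤ m₂) :
    multKR G m₂ Λ₂ Λ₁ +
      (∑ᶠ Λ ∈ {Λ : V | G.dist Λ Λ₁ ≤ m₁}, multKR G m₁ Λ₁ Λ * inumKR G p m₂ Λ₂ Λ)
      = ((m₁ : ℤ) + (m₂ : ℤ) - (G.dist Λ₁ Λ₂ : ℤ)) / 2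
        - (p : ℤ) * (((p : ℤ) ^ m₁ - 1) / ((p : ℤ) - 1)) := by
  have hsum : ∀ Λ ∈ {Λ : V | G.dist Λ Λ₁ ≤ m₁}, multKR G m₁ Λ₁ Λ * inumKR G p m₂ Λ₂ Λ =
      radialMult m₁ (G.dist Λ Λ₁) * radialSign p m₁ (G.dist Λ Λ₁) := by
    intro Λ hΛ
    rw [Set.mem_ofPred_eq] at hΛ
    have htri := htree.connected.dist_triangle (u := Λ) (v := Λ₁) (w := Λ₂)
    have hmod := htree.dist_mod_two Λ Λ₁ Λ₂
    have hle : G.dist Λ Λ₂ ≤ m₂ := by omega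
    have hiff : G.dist Λ Λ₂ % 2 = m₂ % 2 ↔ G.dist Λ Λ₁ % 2 = m₁ % 2 := by omega
    simp only [inumKR, hle, hiff, multKR, radialMult, radialSign, if_true]
  have hgeom : ((p : ℤ) ^ m₁ - 1) / ((p : ℤ) - 1) = ∑ i ∈ Finset.range m₁, (p : ℤ) ^ i :=
    Int.ediv_eq_of_eq_mul_left (by omega) (geom_sum_mul (p : ℤ) m₁).symm
  have hmult : multKR G m₂ Λ₂ Λ₁ =
      ((m₁ : ℤ) + (m₂ : ℤ) - (G.dist Λ₁ Λ₂ : ℤ)) / 2 - (m₁ : ℤ) / 2 := by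
    unfold multKR
    split_ifs <;> omega
  rw [finsum_mem_congr rfl hsum, htree.finsum_mem_ball_dist hdeg Λ₁ m₁
    fun k ↦ radialMult m₁ k * radialSign p m₁ k,
    sum_sphereCard_mul_radialMult_mul_radialSign, hgeom, hmult]
  ring
end

section
/- Let m₁, m₂ be integers with 0 ≤ m₁ ≤ m₂ and let Λ₁, Λ₂ be vertices of G with d := d(Λ₁,Λ₂). Assume m₁ + m₂ ≡ d (mod 2), d ≤ m₁ + m₂, and m₂ < m₁ + d (so that the balls B(Λ₁,m₁) and B(Λ₂,m₂) meet but neither ball is contained in the other). Set r := (m₁ + m₂ − d)/2. Then mult(m₂,Λ₂,Λ₁) + Σ_{Λ ∈ B(Λ₁,m₁)} mult(m₁,Λ₁,Λ)·I(m₂,Λ₂,Λ) = r − p·(p^{r} − 1)/(p − 1). -/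
open SimpleGraph

namespace SimpleGraph

variable {V : Type*} {G : SimpleGraph V}

lemma IsTree.mem_support_of_dist_add_dist_eq (hG : G.IsTree) {a b c : V}
    (hc : G.dist a c + G.dist c b = G.dist a b) (w : G.Walk a b) : c ∈ w.support := by
  classical
  obtain ⟨q₁, h₁⟩ := hG.connected.exists_walk_length_eq_dist a c
  obtain ⟨q₂, h₂⟩ := hG.connected.exists_walk_length_eq_dist c b
  have hq : (q₁.append q₂).IsPath :=
    Walk.isPath_of_length_eq_dist _ (by rw [Walk.length_append, h₁, h₂, hc])
  have hw : w.bypass = q₁.append q₂ := (hG.existsUnique_path a b).unique w.bypass_isPath hq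
  apply w.support_bypass_subset_support
  rw [hw, Walk.mem_support_append_iff]
  exact Or.inl q₁.end_mem_support

lemma Walk.dist_add_dist_eq_of_mem_support (hG : G.Connected) {a b c : V} {w : G.Walk a b}
    (hw : w.length = G.dist a b) (hc : c ∈ w.support) :
    G.dist a c + G.dist c b = G.dist a b := by
  classical
  have h₁ := dist_le (w.takeUntil c hc)
  have h₂ := dist_le (w.dropUntil c hc)
  have h₃ := congrArg Walk.length (w.take_spec hc)
  rw [Walk.length_append] at h₃
  have := hG.dist_triangle (u := a) (v := c) (w := b)
  omega

/-- A vertex of the geodesic from `a` to `b` separates every vertex from `a` or from `b`. -/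
lemma IsTree.dist_eq_or_dist_eq_of_between (hG : G.IsTree) {a b c : V}
    (hc : G.dist a c + G.dist c b = G.dist a b) (v : V) :
    G.dist v c + G.dist c a = G.dist v a ∨ G.dist v c + G.dist c b = G.dist v b := by
  obtain ⟨q₁, h₁⟩ := hG.connected.exists_walk_length_eq_dist v a
  obtain ⟨q₂, h₂⟩ := hG.connected.exists_walk_length_eq_dist v b
  have h := hG.mem_support_of_dist_add_dist_eq hc (q₁.reverse.append q₂)
  rw [Walk.mem_support_append_iff, Walk.support_reverse, List.mem_reverse] at h
  exact h.imp (Walk.dist_add_dist_eq_of_mem_support hG.connected h₁)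
    (Walk.dist_add_dist_eq_of_mem_support hG.connected h₂)

lemma Connected.exists_between (hG : G.Connected) {a b : V} {x y : ℕ}
    (h : x + y = G.dist a b) : ∃ c, G.dist a c = x ∧ G.dist c b = y := by
  obtain ⟨w, hw⟩ := hG.exists_walk_length_eq_dist a b
  have h₁ := dist_le (w.take x)
  have h₂ := dist_le (w.drop x)
  rw [Walk.take_length] at h₁
  rw [Walk.drop_length] at h₂
  have := hG.dist_triangle (u := a) (v := w.getVert x) (w := b)
  exact ⟨w.getVert x, by omega, by omega⟩

lemma IsTree.even_dist_add_dist_add_length (hG : G.IsTree) (a : V) {u v : V} (w : G.Walk u v) :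
    Even (G.dist a u + G.dist a v + w.length) := by
  induction w with
  | nil => simp
  | cons hadj q ih =>
    have := hG.dist_eq_dist_add_one_of_adj a hadj
    rw [Walk.length_cons]
    grind

lemma IsTree.even_dist_add_dist_add_dist (hG : G.IsTree) (a u v : V) :
    Even (G.dist a u + G.dist a v + G.dist u v) := by
  obtain ⟨w, hw⟩ := hG.connected.exists_walk_length_eq_dist u v
  exact hw ▸ hG.even_dist_add_dist_add_length a w

lemma IsTree.exists_parent (hG : G.IsTree) {v c : V} (hv : v ≠ c) :
    ∃ u, G.Adj v u ∧ G.dist u c + 1 = G.dist v c ∧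
      ∀ w, G.Adj v w → w ≠ u → G.dist w c = G.dist v c + 1 := by
  have hpos := hG.connected.pos_dist_of_ne hv
  obtain ⟨u, hvu, huc⟩ := hG.connected.exists_between (a := v) (b := c) (x := 1)
    (y := G.dist v c - 1) (by omega)
  refine ⟨u, dist_eq_one_iff_adj.1 hvu, by omega, fun w hw hne => ?_⟩
  have hwv : G.dist w v = 1 := dist_eq_one_iff_adj.2 hw.symm
  have hwu := hG.connected.pos_dist_of_ne hne
  have h₁ := hG.dist_eq_or_dist_eq_of_between (a := v) (b := c) (c := u) (by omega) w
  have h₂ := hG.dist_eq_dist_add_one_of_adj c hw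
  rw [dist_comm (u := c) (v := v), dist_comm (u := c) (v := w)] at h₂
  rw [dist_comm (u := u) (v := v)] at h₁
  omega

lemma Connected.finite_setOf_dist_le [G.LocallyFinite] (hG : G.Connected) (c : V) (n : ℕ) :
    {v | G.dist v c ≤ n}.Finite := by
  induction n with
  | zero =>
    refine (Set.finite_singleton c).subset fun v hv => ?_
    simpa [hG.dist_eq_zero_iff] using hv
  | succ n ih =>
    refine (ih.union (ih.biUnion fun u _ => (G.neighborSet u).toFinite)).subset fun v hv => ?_
    rcases Nat.lt_or_ge n (G.dist v c) with h | h
    · obtain ⟨u, hvu, huc⟩ := hG.exists_between (a := v) (b := c) (x := 1) (y := n)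
        (by have : G.dist v c ≤ n + 1 := hv
            omega)
      exact Or.inr (Set.mem_biUnion (x := u) huc.le (dist_eq_one_iff_adj.1 hvu).symm)
    · exact Or.inl h

lemma sum_mul_sum_neighborFinset_comm [G.LocallyFinite] {S : Finset V} (f g : V → ℤ)
    (hg : ∀ v, g v ≠ 0 → v ∈ S ∧ ∀ w, G.Adj v w → w ∈ S) :
    ∑ v ∈ S, f v * ∑ w ∈ G.neighborFinset v, g w =
      ∑ v ∈ S, g v * ∑ w ∈ G.neighborFinset v, f w := by
  classical
  have h₁ : ∀ v, ∑ w ∈ G.neighborFinset v, g w = ∑ w ∈ S, if G.Adj v w then g w else 0 := by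
    intro v
    rw [← Finset.sum_filter]
    refine (Finset.sum_subset_zero_on_sdiff (fun w hw => ?_) (fun w hw => ?_)
      fun _ _ => rfl).symm
    · simpa using (Finset.mem_filter.1 hw).2
    · by_contra hne
      simp_all
  have h₂ : ∀ v, g v * ∑ w ∈ G.neighborFinset v, f w =
      g v * ∑ w ∈ S, if G.Adj v w then f w else 0 := by
    intro v
    by_cases hv : g v = 0
    · simp [hv]
    · rw [← Finset.sum_filter]
      congr 1
      refine Finset.sum_congr (Finset.ext fun w => ?_) fun _ _ => rfl
      simpa using (hg v hv).2 w
  simp_rw [h₁, h₂, Finset.mul_sum]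
  rw [Finset.sum_comm]
  refine Finset.sum_congr rfl fun v _ => Finset.sum_congr rfl fun w _ => ?_
  simp only [G.adj_comm w v]
  split_ifs <;> ring

end SimpleGraph

section KudlaRapoport

variable {V : Type*} {G : SimpleGraph V} {p : ℕ}

lemma multKR_eq (m : ℕ) (Λ₀ Λ : V) :
    multKR G m Λ₀ Λ = (((m + 1 - G.dist Λ Λ₀) / 2 : ℕ) : ℤ) := by
  unfold multKR
  split_ifs <;> omega

lemma multKR_ne_zero {m : ℕ} {Λ₀ Λ : V} (h : multKR G m Λ₀ Λ ≠ 0) : G.dist Λ Λ₀ < m := by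
  rw [multKR_eq] at h
  omega

/-- The radial Laplacian of `multKR` is `inumKR` minus a point mass at the centre. -/
lemma sum_neighborFinset_multKR [G.LocallyFinite] (hG : G.IsTree)
    (hdeg : G.IsRegularOfDegree (p + 1)) (m : ℕ) (c v : V) [Decidable (v = c)] :
    ∑ w ∈ G.neighborFinset v, multKR G m c w =
      (p + 1) * multKR G m c v + inumKR G p m c v - if v = c then 1 else 0 := by
  classical
  have hcard : (G.neighborFinset v).card = p + 1 := hdeg v
  simp_rw [multKR_eq]
  by_cases hv : v = c
  · subst hv
    have h : ∀ w ∈ G.neighborFinset v,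
        (((m + 1 - G.dist w v) / 2 : ℕ) : ℤ) = ((m / 2 : ℕ) : ℤ) := by
      intro w hw
      rw [mem_neighborFinset] at hw
      rw [dist_eq_one_iff_adj.2 hw.symm, Nat.add_sub_cancel]
    rw [Finset.sum_congr rfl h, Finset.sum_const, hcard, nsmul_eq_mul]
    simp only [inumKR, dist_self, Nat.zero_le, if_true, Nat.sub_zero]
    push_cast
    split_ifs with hpar
    · rw [show ((m : ℤ) + 1) / 2 = m / 2 by omega]
      ring
    · rw [show ((m : ℤ) + 1) / 2 = m / 2 + 1 by omega]
      ring
  · obtain ⟨u, hvu, huc, hother⟩ := hG.exists_parent hv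
    have hu : u ∈ G.neighborFinset v := by simpa using hvu
    have h : ∀ w ∈ (G.neighborFinset v).erase u,
        (((m + 1 - G.dist w c) / 2 : ℕ) : ℤ) = (((m - G.dist v c) / 2 : ℕ) : ℤ) := by
      intro w hw
      rw [Finset.mem_erase, mem_neighborFinset] at hw
      rw [hother w hw.2 hw.1, Nat.add_sub_add_right]
    rw [← Finset.add_sum_erase _ _ hu, Finset.sum_congr rfl h, Finset.sum_const,
      Finset.card_erase_of_mem hu, hcard, nsmul_eq_mul, if_neg hv, Nat.add_sub_cancel,
      show m + 1 - G.dist u c = m + 1 - (G.dist v c - 1) by omega]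
    unfold inumKR
    generalize G.dist v c = d at *
    split_ifs with hd hpar
    · rw [show (m + 1 - (d - 1)) / 2 = (m - d) / 2 + 1 by omega,
        show (m + 1 - d) / 2 = (m - d) / 2 by omega]
      push_cast
      ring
    · rw [show (m + 1 - (d - 1)) / 2 = (m - d) / 2 + 1 by omega,
        show (m + 1 - d) / 2 = (m - d) / 2 + 1 by omega]
      push_cast
      ring
    · rw [show (m + 1 - (d - 1)) / 2 = 0 by omega, show (m + 1 - d) / 2 = 0 by omega,
        show (m - d) / 2 = 0 by omega]
      simp

lemma sum_mul_inumKR [G.LocallyFinite] (hG : G.IsTree) (hdeg : G.IsRegularOfDegree (p + 1))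
    {m : ℕ} {c : V} {S : Finset V} (hS : ∀ v, G.dist v c ≤ m → v ∈ S) (f : V → ℤ) :
    ∑ v ∈ S, f v * inumKR G p m c v = f c +
      ∑ v ∈ S, multKR G m c v * (∑ w ∈ G.neighborFinset v, f w - (p + 1) * f v) := by
  classical
  have hgreen := sum_mul_sum_neighborFinset_comm (G := G) (S := S) f (multKR G m c) (by
    intro v hv
    have hvm := multKR_ne_zero hv
    refine ⟨hS v hvm.le, fun w hw => hS w ?_⟩
    have := hG.connected.dist_triangle (u := w) (v := v) (w := c)
    have := dist_eq_one_iff_adj.2 hw.symm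
    omega)
  have hcS : c ∈ S := hS c (by simp)
  have hpoint : ∑ v ∈ S, f v * (if v = c then 1 else 0) = f c := by
    simp [hcS]
  rw [← hpoint]
  simp_rw [mul_sub, Finset.sum_sub_distrib, ← hgreen, sum_neighborFinset_multKR hG hdeg]
  simp_rw [← Finset.sum_sub_distrib, ← Finset.sum_add_distrib]
  exact Finset.sum_congr rfl fun v _ => by ring

lemma sum_inumKR [G.LocallyFinite] (hG : G.IsTree) (hdeg : G.IsRegularOfDegree (p + 1))
    {m : ℕ} {c : V} {S : Finset V} (hS : ∀ v, G.dist v c ≤ m → v ∈ S) :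
    ∑ v ∈ S, inumKR G p m c v = 1 := by
  have h := sum_mul_inumKR hG hdeg hS fun _ => 1
  have hcard : ∀ v, (G.neighborFinset v).card = p + 1 := hdeg
  simpa [hcard] using h

/-- The sum over the vertices at distance at most `m` from `c`, at a distance congruent to `m`. -/
lemma sum_inumKR_zero [G.LocallyFinite] (hG : G.IsTree) (hdeg : G.IsRegularOfDegree (p + 1))
    {m : ℕ} {c : V} {S : Finset V} (hS : ∀ v, G.dist v c ≤ m → v ∈ S) :
    ∑ v ∈ S, inumKR G 0 m c v = ∑ i ∈ Finset.range (m + 1), (p : ℤ) ^ i := by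
  induction m with
  | zero =>
    rw [← Finset.sum_congr rfl fun v _ => show inumKR G p 0 c v = inumKR G 0 0 c v by
      unfold inumKR
      split_ifs <;> omega]
    simpa using sum_inumKR hG hdeg hS
  | succ m ih =>
    have h₁ : ∀ v ∈ S, inumKR G 0 (m + 1) c v =
        inumKR G p (m + 1) c v + p * inumKR G 0 m c v := by
      intro v _
      unfold inumKR
      split_ifs <;> omega
    rw [Finset.sum_congr rfl h₁, Finset.sum_add_distrib, ← Finset.mul_sum, sum_inumKR hG hdeg hS,
      ih fun v hv => hS v (by omega), Finset.sum_range_succ' _ (m + 1), Finset.mul_sum]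
    simp_rw [pow_succ']
    ring

lemma sum_multKR_mul_inumKR_self [G.LocallyFinite] (hG : G.IsTree)
    (hdeg : G.IsRegularOfDegree (p + 1)) {m : ℕ} {c : V} {S : Finset V}
    (hS : ∀ v, G.dist v c ≤ m → v ∈ S) :
    ∑ v ∈ S, multKR G m c v * inumKR G p m c v =
      ((m / 2 : ℕ) : ℤ) - p * ∑ i ∈ Finset.range m, (p : ℤ) ^ i := by
  induction m using Nat.twoStepInduction with
  | zero =>
    have h : ∀ v, multKR G 0 c v = 0 := fun v => by
      rw [multKR_eq]
      omega
    simp [h]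
  | one =>
    have h : ∀ v ∈ S, multKR G 1 c v * inumKR G p 1 c v = -p * inumKR G 0 0 c v := by
      intro v _
      rw [multKR_eq]
      unfold inumKR
      rcases hd : G.dist v c with _ | d
      · simp
      · rw [show (1 + 1 - (d + 1)) / 2 = 0 by omega]
        simp
    rw [Finset.sum_congr rfl h, ← Finset.mul_sum,
      sum_inumKR_zero hG hdeg fun v hv => hS v (by omega)]
    simp
  | more m ih _ =>
    have h : ∀ v ∈ S, multKR G (m + 2) c v * inumKR G p (m + 2) c v =
        multKR G m c v * inumKR G p m c v +
          (inumKR G 0 m c v - p * inumKR G 0 (m + 1) c v) := by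
      intro v _
      simp_rw [multKR_eq]
      unfold inumKR
      generalize G.dist v c = d
      rcases Nat.lt_or_ge m d with hmd | hmd
      · rw [show (m + 2 + 1 - d) / 2 = if d ≤ m + 1 then 1 else 0 by split_ifs <;> omega]
        split_ifs <;> omega
      · rw [show (m + 2 + 1 - d) / 2 = (m + 1 - d) / 2 + 1 by omega]
        split_ifs <;> first | omega | (push_cast; ring)
    rw [Finset.sum_congr rfl h, Finset.sum_add_distrib, Finset.sum_sub_distrib, ← Finset.mul_sum,
      ih fun v hv => hS v (by omega), sum_inumKR_zero hG hdeg fun v hv => hS v (by omega),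
      sum_inumKR_zero hG hdeg fun v hv => hS v (by omega), Nat.add_div_right m two_pos]
    have hgeom := geom_sum_mul (p : ℤ) m
    simp_rw [Finset.sum_range_succ]
    push_cast
    linear_combination -hgeom

end KudlaRapoport

theorem statement1 {V : Type*} (p : ℕ) (hp : 2 ≤ p) (G : SimpleGraph V)
    (htree : G.IsTree) (hdeg : ∀ v : V, (G.neighborSet v).ncard = p + 1)
    (m₁ m₂ : ℕ) (hm : m₁ ≤ m₂) (Λ₁ Λ₂ : V)
    (hpar : (m₁ + m₂) % 2 = G.dist Λ₁ Λ₂ % 2)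
    (hmeet : G.dist Λ₁ Λ₂ ≤ m₁ + m₂)
    (hnotsub : m₂ < m₁ + G.dist Λ₁ Λ₂) :
    multKR G m₂ Λ₂ Λ₁ +
      (∑ᶠ Λ ∈ {Λ : V | G.dist Λ Λ₁ ≤ m₁}, multKR G m₁ Λ₁ Λ * inumKR G p m₂ Λ₂ Λ)
      = (((m₁ + m₂ - G.dist Λ₁ Λ₂) / 2 : ℕ) : ℤ)
        - (p : ℤ) * (((p : ℤ) ^ ((m₁ + m₂ - G.dist Λ₁ Λ₂) / 2) - 1) / ((p : ℤ) - 1)) := by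
  classical
  have hG := htree.connected
  let : G.LocallyFinite := fun v =>
    (Set.finite_of_ncard_pos (by rw [hdeg v]; omega)).fintype
  have hreg : G.IsRegularOfDegree (p + 1) := fun v => by
    rw [← hdeg v, Set.ncard_eq_toFinset_card', ← card_neighborFinset_eq_degree, neighborFinset]
  obtain ⟨r, hr⟩ : ∃ r, m₁ + m₂ - G.dist Λ₁ Λ₂ = 2 * r :=
    ⟨(m₁ + m₂ - G.dist Λ₁ Λ₂) / 2, by omega⟩
  obtain ⟨c, hc₁, hc₂⟩ := hG.exists_between (a := Λ₁) (b := Λ₂) (x := m₁ - r) (y := m₂ - r)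
    (by omega)
  have hball : ∀ v, G.dist v Λ₁ ≤ m₁ → G.dist v Λ₂ ≤ m₂ → G.dist v c ≤ r := by
    intro v h₁ h₂
    have h := htree.dist_eq_or_dist_eq_of_between (a := Λ₁) (b := Λ₂) (c := c) (by omega) v
    rw [dist_comm (u := c) (v := Λ₁)] at h
    omega
  have hball₁ : ∀ v, G.dist v c ≤ r → G.dist v Λ₁ ≤ m₁ := by
    intro v hv
    have := hG.dist_triangle (u := v) (v := c) (w := Λ₁)
    rw [dist_comm (u := c) (v := Λ₁)] at this
    omega
  have hball₂ : ∀ v, G.dist v c ≤ r → G.dist v Λ₂ ≤ m₂ := by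
    intro v hv
    have := hG.dist_triangle (u := v) (v := c) (w := Λ₂)
    omega
  set S : Finset V := (hG.finite_setOf_dist_le Λ₁ m₁).toFinset with hSdef
  have hS₁ : ∀ v, G.dist v Λ₁ ≤ m₁ → v ∈ S := by simp [hSdef]
  have hSc : ∀ v, G.dist v c ≤ r → v ∈ S := fun v hv => hS₁ v (hball₁ v hv)
  have hcentre : ∑ v ∈ S, multKR G m₁ Λ₁ v * inumKR G p m₂ Λ₂ v =
      ∑ v ∈ S, multKR G m₁ Λ₁ v * inumKR G p r c v := by
    refine Finset.sum_congr rfl fun v hv => ?_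
    have hv₁ : G.dist v Λ₁ ≤ m₁ := by simpa [hSdef] using hv
    congr 1
    have h₁ := hball v hv₁
    have h₂ := hball₂ v
    have h₃ := htree.even_dist_add_dist_add_dist v c Λ₂
    rw [Nat.even_iff] at h₃
    unfold inumKR
    split_ifs <;> first | rfl | omega
  have hsymm : ∑ v ∈ S, multKR G r c v * inumKR G p m₁ Λ₁ v =
      ∑ v ∈ S, multKR G r c v * inumKR G p r c v := by
    refine Finset.sum_congr rfl fun v _ => ?_
    by_cases hv : multKR G r c v = 0
    · simp [hv]
    · have hvr := multKR_ne_zero hv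
      congr 1
      have h₁ := hball₁ v
      have h₂ := htree.even_dist_add_dist_add_dist v c Λ₁
      rw [Nat.even_iff, dist_comm (u := c) (v := Λ₁)] at h₂
      unfold inumKR
      split_ifs <;> first | rfl | omega
  have hsum : ∑ v ∈ S, multKR G m₁ Λ₁ v * inumKR G p r c v =
      multKR G m₁ Λ₁ c + ((∑ v ∈ S, multKR G r c v * inumKR G p r c v) - multKR G r c Λ₁) := by
    rw [sum_mul_inumKR htree hreg hSc, ← hsymm]
    have hΛ₁ : Λ₁ ∈ S := hS₁ Λ₁ (by simp)
    have hpoint : ∑ v ∈ S, multKR G r c v * (if v = Λ₁ then 1 else 0) = multKR G r c Λ₁ := by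
      simp [hΛ₁]
    rw [← hpoint, ← Finset.sum_sub_distrib]
    simp_rw [sum_neighborFinset_multKR htree hreg]
    congr 1
    exact Finset.sum_congr rfl fun v _ => by ring
  have hfinsum : (∑ᶠ Λ ∈ {Λ : V | G.dist Λ Λ₁ ≤ m₁}, multKR G m₁ Λ₁ Λ * inumKR G p m₂ Λ₂ Λ) =
      ∑ v ∈ S, multKR G m₁ Λ₁ v * inumKR G p m₂ Λ₂ v :=
    finsum_mem_eq_finite_toFinset_sum _ _
  have hgeom : ((p : ℤ) ^ r - 1) / ((p : ℤ) - 1) = ∑ i ∈ Finset.range r, (p : ℤ) ^ i := by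
    rw [← geom_sum_mul, Int.mul_ediv_cancel _ (by omega)]
  rw [hfinsum, hcentre, hsum, sum_multKR_mul_inumKR_self htree hreg hSc, hr,
    Nat.mul_div_cancel_left r two_pos, hgeom]
  simp_rw [multKR_eq]
  rw [dist_comm (u := c) (v := Λ₁), hc₁,
    show (m₂ + 1 - G.dist Λ₁ Λ₂) / 2 = (r + 1 - (m₁ - r)) / 2 by omega,
    show (m₁ + 1 - (m₁ - r)) / 2 = (r + 1) / 2 by omega]
  have hhalf : (((r + 1) / 2 : ℕ) : ℤ) + ((r / 2 : ℕ) : ℤ) = r := by omega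
  linear_combination hhalf
end

section
/- For every integer m₂ ≥ 0 and all vertices Λ₂ and Λ of G, one has δ_{Λ,Λ₂} − (p+1)·mult(m₂,Λ₂,Λ) + Σ_{Λ' adjacent to Λ} mult(m₂,Λ₂,Λ') = I(m₂,Λ₂,Λ), where δ_{Λ,Λ₂} = 1 if Λ = Λ₂ and δ_{Λ,Λ₂} = 0 otherwise. (The left-hand side is the expansion of the intersection number ⟨ℙ_Λ, Z(b₂)⟩ into the horizontal contribution δ_{Λ,Λ₂} and the contributions mult(m₂,Λ₂,Λ')·⟨ℙ_Λ,ℙ_{Λ'}⟩, using ⟨ℙ_Λ,ℙ_Λ⟩ = −(p+1), ⟨ℙ_Λ,ℙ_{Λ'}⟩ = 1 for adjacent Λ,Λ', and 0 otherwise.) -/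
open SimpleGraph

/-- In a tree, every vertex other than `u` has a unique neighbor closer to `u`. -/
theorem SimpleGraph.IsTree.existsUnique_adj_dist_add_one_s3 {V : Type*} {G : SimpleGraph V}
    (hG : G.IsTree) {u v : V} (huv : v ≠ u) :
    ∃! w, G.Adj v w ∧ G.dist w u + 1 = G.dist v u := by
  obtain ⟨q, hq, hlen⟩ := hG.connected.exists_path_of_dist v u
  have hnil : ¬ q.Nil := Walk.not_nil_of_ne huv
  refine ⟨q.snd, ⟨q.adj_snd hnil, ?_⟩, ?_⟩
  · have h₁ := dist_le q.tail
    have h₂ := Walk.length_tail_add_one hnil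
    have h₃ := hG.dist_eq_dist_add_one_of_adj u (q.adj_snd hnil)
    rw [dist_comm (u := u) (v := v), dist_comm (u := u) (v := q.snd)] at h₃
    omega
  · rintro w ⟨hadj, hw⟩
    obtain ⟨r, -, hr⟩ := hG.connected.exists_path_of_dist w u
    have hpath : (Walk.cons hadj r).IsPath :=
      Walk.isPath_of_length_eq_dist _ (by rw [Walk.length_cons, hr, hw])
    have heq := (hG.existsUnique_path v u).unique hpath hq
    rw [← heq, Walk.snd_cons]

/-- In a tree, a neighbor sum of a function of the distance to `u`, evaluated at a vertex `v ≠ u`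
of degree `p + 1`, has one term from the neighbor closer to `u` and `p` terms from the others. -/
theorem SimpleGraph.IsTree.finsum_neighborSet_dist {V : Type*} {G : SimpleGraph V}
    (hG : G.IsTree) {p : ℕ} {u v : V} (hdeg : (G.neighborSet v).ncard = p + 1) (huv : v ≠ u)
    (f : ℕ → ℤ) :
    ∑ᶠ w ∈ G.neighborSet v, f (G.dist w u) = f (G.dist v u - 1) + p * f (G.dist v u + 1) := by
  classical
  have hfin : (G.neighborSet v).Finite := Set.finite_of_ncard_ne_zero (by omega)
  obtain ⟨w₀, ⟨hadj₀, hw₀⟩, huniq⟩ := hG.existsUnique_adj_dist_add_one_s3 huv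
  have hmem : w₀ ∈ hfin.toFinset := by simpa using hadj₀
  have hother : ∀ w ∈ hfin.toFinset.erase w₀, f (G.dist w u) = f (G.dist v u + 1) := by
    intro w hw
    rw [Finset.mem_erase, Set.Finite.mem_toFinset, mem_neighborSet] at hw
    have h₁ := hG.dist_eq_dist_add_one_of_adj u hw.2
    rw [dist_comm (u := u) (v := v), dist_comm (u := u) (v := w)] at h₁
    have h₂ : G.dist w u + 1 ≠ G.dist v u := fun h ↦ hw.1 (huniq w ⟨hw.2, h⟩)
    congr 1
    omega
  rw [finsum_mem_eq_finite_toFinset_sum _ hfin, ← Finset.add_sum_erase _ _ hmem,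
    Finset.sum_congr rfl hother, Finset.sum_const, Finset.card_erase_of_mem hmem,
    ← Set.ncard_eq_toFinset_card _ hfin, hdeg, nsmul_eq_mul, Nat.add_sub_cancel, ← hw₀,
    Nat.add_sub_cancel]

/-- A neighbor sum of a function of the distance to `v`, evaluated at `v` itself. -/
theorem SimpleGraph.finsum_neighborSet_dist_self {V : Type*} {G : SimpleGraph V} (v : V)
    (hfin : (G.neighborSet v).Finite) (f : ℕ → ℤ) :
    ∑ᶠ w ∈ G.neighborSet v, f (G.dist w v) = (G.neighborSet v).ncard * f 1 := by
  have hone : ∀ w ∈ hfin.toFinset, f (G.dist w v) = f 1 := by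
    intro w hw
    rw [Set.Finite.mem_toFinset, mem_neighborSet] at hw
    rw [dist_eq_one_iff_adj.mpr hw.symm]
  rw [finsum_mem_eq_finite_toFinset_sum _ hfin, Finset.sum_congr rfl hone, Finset.sum_const,
    ← Set.ncard_eq_toFinset_card _ hfin, nsmul_eq_mul]

/-- The multiplicity `mult(m, Λ₀, Λ)` as a function of the distance `d = d(Λ, Λ₀)`. -/
def multOfDist (m d : ℕ) : ℤ := ((m + 1 - d) / 2 : ℕ)

theorem multKR_eq_multOfDist {V : Type*} (G : SimpleGraph V) (m : ℕ) (Λ₀ Λ : V) :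
    multKR G m Λ₀ Λ = multOfDist m (G.dist Λ Λ₀) := by
  unfold multKR multOfDist
  split_ifs <;> omega

theorem statement3 {V : Type*} [DecidableEq V] (p : ℕ) (hp : 2 ≤ p) (G : SimpleGraph V)
    (htree : G.IsTree) (hdeg : ∀ v : V, (G.neighborSet v).ncard = p + 1)
    (m₂ : ℕ) (Λ₂ Λ : V) :
    (if Λ = Λ₂ then (1 : ℤ) else 0) - ((p : ℤ) + 1) * multKR G m₂ Λ₂ Λ
      + (∑ᶠ Λ' ∈ G.neighborSet Λ, multKR G m₂ Λ₂ Λ')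
      = inumKR G p m₂ Λ₂ Λ := by
  simp only [multKR_eq_multOfDist]
  by_cases h : Λ = Λ₂
  · subst h
    have hfin : (G.neighborSet Λ).Finite :=
      Set.finite_of_ncard_ne_zero (by rw [hdeg]; exact p.succ_ne_zero)
    rw [finsum_neighborSet_dist_self Λ hfin, hdeg, if_pos rfl, inumKR, dist_self,
      if_pos m₂.zero_le]
    split_ifs with hpar
    · have h₁ : multOfDist m₂ 0 = multOfDist m₂ 1 := by unfold multOfDist; omega
      rw [h₁]; push_cast; ring
    · have h₁ : multOfDist m₂ 0 = multOfDist m₂ 1 + 1 := by unfold multOfDist; omega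
      rw [h₁]; push_cast; ring
  · have hpos := htree.connected.pos_dist_of_ne h
    rw [htree.finsum_neighborSet_dist (hdeg Λ) h, if_neg h, inumKR]
    generalize G.dist Λ Λ₂ = d at hpos ⊢
    split_ifs with hle hpar
    · have h₁ : multOfDist m₂ (d - 1) = multOfDist m₂ d + 1 := by unfold multOfDist; omega
      have h₂ : multOfDist m₂ (d + 1) = multOfDist m₂ d := by unfold multOfDist; omega
      rw [h₁, h₂]; ring
    · have h₁ : multOfDist m₂ (d - 1) = multOfDist m₂ d := by unfold multOfDist; omega
      have h₂ : multOfDist m₂ (d + 1) = multOfDist m₂ d - 1 := by unfold multOfDist; omega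
      rw [h₁, h₂]; ring
    · have h₀ : multOfDist m₂ d = 0 := by unfold multOfDist; omega
      have h₁ : multOfDist m₂ (d - 1) = 0 := by unfold multOfDist; omega
      have h₂ : multOfDist m₂ (d + 1) = 0 := by unfold multOfDist; omega
      rw [h₀, h₁, h₂]; ring
end

section
/- Let m₁, m₂ be integers with 0 ≤ m₁ ≤ m₂, m₁ even, and let Λ₁, Λ₂ be vertices of G with d := d(Λ₁,Λ₂) satisfying d ≡ m₂ (mod 2) and d + m₁ ≤ m₂. Then Σ_{Λ ∈ B(Λ₁,m₁)} mult(m₁,Λ₁,Λ)·I(m₂,Λ₂,Λ) = m₁/2 − p·(p^{m₁} − 1)/(p − 1). -/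
open SimpleGraph

/-- In a tree, a vertex `w ≠ u` has exactly one neighbour closer to `u`. -/
lemma existsUnique_adj_dist_of_isTree {V : Type*} {G : SimpleGraph V} (hG : G.IsTree)
    {u w : V} {r : ℕ} (hw : G.dist w u = r + 1) :
    ∃! v, G.Adj w v ∧ G.dist v u = r := by
  have hconn := hG.connected
  obtain ⟨q, hq⟩ := hconn.exists_walk_length_eq_dist w u
  cases q with
  | nil => simp at hw
  | @cons _ x _ hx q =>
    have hxu : G.dist x u = r := by
      have h₁ := G.dist_le q
      have h₂ := hconn.dist_triangle (u := w) (v := x) (w := u)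
      rw [dist_eq_one_iff_adj.mpr hx] at h₂
      rw [Walk.length_cons] at hq
      omega
    refine ⟨x, ⟨hx, hxu⟩, fun y ⟨hy, hyu⟩ ↦ ?_⟩
    obtain ⟨a, ha⟩ := hconn.exists_walk_length_eq_dist x u
    obtain ⟨b, hb⟩ := hconn.exists_walk_length_eq_dist y u
    have hpa : (Walk.cons hx a).IsPath :=
      Walk.isPath_of_length_eq_dist _ (by rw [Walk.length_cons]; omega)
    have hpb : (Walk.cons hy b).IsPath :=
      Walk.isPath_of_length_eq_dist _ (by rw [Walk.length_cons]; omega)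
    have h := congrArg Walk.snd
      (congrArg Subtype.val ((hG.isAcyclic.subsingleton_path w u).elim ⟨_, hpb⟩ ⟨_, hpa⟩))
    simpa using h

/-- In a `(p+1)`-regular tree, a vertex at distance `r + 1` from `u` has `p` neighbours at
distance `r + 2` from `u`. -/
lemma ncard_adj_dist_of_isTree {V : Type*} {p : ℕ} {G : SimpleGraph V} (hG : G.IsTree)
    (hdeg : ∀ v : V, (G.neighborSet v).ncard = p + 1) {u w : V} {r : ℕ}
    (hw : G.dist w u = r + 1) :
    {v | G.Adj w v ∧ G.dist v u = r + 2}.ncard = p := by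
  obtain ⟨x, ⟨hx, hxu⟩, huniq⟩ := existsUnique_adj_dist_of_isTree hG hw
  have hset : {v | G.Adj w v ∧ G.dist v u = r + 2} = G.neighborSet w \ {x} := by
    ext v
    simp only [Set.mem_ofPred_eq, Set.mem_sdiff, mem_neighborSet, Set.mem_singleton_iff]
    refine and_congr_right fun hv ↦ ⟨fun h hvx ↦ ?_, fun h ↦ ?_⟩
    · rw [hvx] at h
      omega
    · have h' := hG.dist_eq_dist_add_one_of_adj u hv
      rw [dist_comm, dist_comm (u := u) (v := v)] at h'
      have : G.dist v u ≠ r := fun hr ↦ h (huniq v ⟨hv, hr⟩)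
      omega
  rw [hset, Set.ncard_sdiff_singleton_of_mem ((G.mem_neighborSet w x).mpr hx), hdeg,
    Nat.add_sub_cancel]

/-- The sphere of radius `r + 1` in a `(p+1)`-regular tree has `(p + 1) * p ^ r` vertices. -/
lemma exists_finset_sphere_of_isTree {V : Type*} {p : ℕ} {G : SimpleGraph V} (hG : G.IsTree)
    (hdeg : ∀ v : V, (G.neighborSet v).ncard = p + 1) (u : V) (r : ℕ) :
    ∃ S : Finset V, (∀ v, v ∈ S ↔ G.dist v u = r + 1) ∧ S.card = (p + 1) * p ^ r := by
  classical
  have hfin : ∀ v, (G.neighborSet v).Finite := fun v ↦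
    Set.finite_of_ncard_ne_zero (by rw [hdeg]; omega)
  induction r with
  | zero =>
    refine ⟨(hfin u).toFinset, fun v ↦ ?_, ?_⟩
    · rw [Set.Finite.mem_toFinset, mem_neighborSet, zero_add, dist_eq_one_iff_adj, adj_comm]
    · rw [← Set.ncard_eq_toFinset_card _ (hfin u), hdeg, pow_zero, mul_one]
  | succ r ih =>
    obtain ⟨S, hS, hcard⟩ := ih
    have hfin' : ∀ w, {v | G.Adj w v ∧ G.dist v u = r + 2}.Finite := fun w ↦
      (hfin w).subset fun v hv ↦ hv.1
    refine ⟨S.biUnion fun w ↦ (hfin' w).toFinset, fun v ↦ ?_, ?_⟩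
    · simp only [Finset.mem_biUnion, Set.Finite.mem_toFinset, Set.mem_ofPred_eq]
      constructor
      · rintro ⟨w, -, -, h⟩
        exact h
      · intro h
        obtain ⟨w, ⟨hw, hwu⟩, -⟩ := existsUnique_adj_dist_of_isTree hG h
        exact ⟨w, (hS w).mpr hwu, hw.symm, h⟩
    · have hcard' : ∀ w ∈ S, (hfin' w).toFinset.card = p := fun w hw ↦ by
        rw [← Set.ncard_eq_toFinset_card _ (hfin' w),
          ncard_adj_dist_of_isTree hG hdeg ((hS w).mp hw)]
      rw [Finset.card_biUnion, Finset.sum_congr rfl hcard', Finset.sum_const, hcard,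
        smul_eq_mul, pow_succ, mul_assoc]
      intro w hw w' hw' hne
      rw [Function.onFun, Finset.disjoint_left]
      intro v hv hv'
      simp only [Set.Finite.mem_toFinset, Set.mem_ofPred_eq] at hv hv'
      exact hne ((existsUnique_adj_dist_of_isTree hG hv.2).unique
        ⟨hv.1.symm, (hS w).mp hw⟩ ⟨hv'.1.symm, (hS w').mp hw'⟩)

/-- The sum of a radial function over a ball in a `(p+1)`-regular tree. -/
lemma finsum_mem_ball_of_isTree {V : Type*} {p : ℕ} {G : SimpleGraph V} (hG : G.IsTree)
    (hdeg : ∀ v : V, (G.neighborSet v).ncard = p + 1) (u : V) (f : ℕ → ℤ) (m : ℕ) :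
    ∑ᶠ v ∈ {v | G.dist v u ≤ m}, f (G.dist v u)
      = f 0 + ∑ r ∈ Finset.range m, (p + 1) * (p : ℤ) ^ r * f (r + 1) := by
  suffices {v | G.dist v u ≤ m}.Finite ∧ ∑ᶠ v ∈ {v | G.dist v u ≤ m}, f (G.dist v u)
      = f 0 + ∑ r ∈ Finset.range m, (p + 1) * (p : ℤ) ^ r * f (r + 1) from this.2
  induction m with
  | zero =>
    have hset : {v | G.dist v u ≤ 0} = {u} := by
      ext v
      simp [hG.connected.dist_eq_zero_iff]
    rw [hset, finsum_mem_singleton]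
    simp
  | succ m ih =>
    obtain ⟨hfin, hsum⟩ := ih
    obtain ⟨S, hS, hcard⟩ := exists_finset_sphere_of_isTree hG hdeg u m
    have hset : {v | G.dist v u ≤ m + 1} = {v | G.dist v u ≤ m} ∪ S := by
      ext v
      simp only [Set.mem_union, Set.mem_ofPred_eq, Finset.mem_coe, hS]
      omega
    have hdisj : Disjoint {v | G.dist v u ≤ m} (S : Set V) := by
      rw [Set.disjoint_left]
      intro v hv hv'
      rw [Finset.mem_coe, hS] at hv'
      rw [Set.mem_ofPred_eq] at hv
      omega
    have hsphere : ∑ v ∈ S, f (G.dist v u) = (p + 1) * (p : ℤ) ^ m * f (m + 1) := by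
      rw [Finset.sum_congr rfl fun v hv ↦ by rw [(hS v).mp hv], Finset.sum_const, hcard]
      simp
    refine ⟨hset ▸ hfin.union S.finite_toSet, ?_⟩
    rw [hset, finsum_mem_union hdisj hfin S.finite_toSet, hsum, finsum_mem_coe_finset, hsphere,
      Finset.sum_range_succ, add_assoc]

/-- In a tree, `d(w, v) ≡ d(w, u) + d(u, v)` modulo `2`. -/
lemma dist_mod_two_of_isTree {V : Type*} {G : SimpleGraph V} (hG : G.IsTree) (u v w : V) :
    G.dist w v % 2 = (G.dist w u + G.dist u v) % 2 := by
  obtain ⟨q⟩ := hG.connected w u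
  induction q with
  | nil => simp
  | @cons a b c h q ih =>
    have h₁ := hG.dist_eq_dist_add_one_of_adj v h
    have h₂ := hG.dist_eq_dist_add_one_of_adj c h
    rw [dist_comm, dist_comm (v := b)] at h₁ h₂
    omega

lemma sum_range_two_mul_geom (p : ℤ) (k : ℤ) (f : ℕ → ℤ)
    (hodd : ∀ j : ℕ, f (2 * j + 1) = -p * (k - j)) (heven : ∀ j : ℕ, f (2 * j) = k - j) (n : ℕ) :
    ∑ r ∈ Finset.range (2 * n), (p + 1) * p ^ r * f (r + 1)
      = -(p * ∑ r ∈ Finset.range (2 * n), p ^ r) := by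
  induction n with
  | zero => simp
  | succ n ih =>
    rw [mul_add, mul_one, Finset.sum_range_succ, Finset.sum_range_succ, ih,
      Finset.sum_range_succ, Finset.sum_range_succ, hodd,
      show 2 * n + 1 + 1 = 2 * (n + 1) by ring, heven]
    push_cast
    ring

theorem statement4 {V : Type*} (p : ℕ) (hp : 2 ≤ p) (G : SimpleGraph V)
    (htree : G.IsTree) (hdeg : ∀ v : V, (G.neighborSet v).ncard = p + 1)
    (m₁ m₂ : ℕ) (hm : m₁ ≤ m₂) (hm₁even : Even m₁) (Λ₁ Λ₂ : V)
    (hpar : G.dist Λ₁ Λ₂ % 2 = m₂ % 2)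
    (hball : G.dist Λ₁ Λ₂ + m₁ ≤ m₂) :
    (∑ᶠ Λ ∈ {Λ : V | G.dist Λ Λ₁ ≤ m₁}, multKR G m₁ Λ₁ Λ * inumKR G p m₂ Λ₂ Λ)
      = ((m₁ : ℤ) / 2) - (p : ℤ) * (((p : ℤ) ^ m₁ - 1) / ((p : ℤ) - 1)) := by
  obtain ⟨k, rfl⟩ := hm₁even.exists_two_nsmul
  rw [smul_eq_mul] at *
  set f : ℕ → ℤ := fun r ↦
    if r % 2 = 0 then (k : ℤ) - (r / 2 : ℕ) else -(p : ℤ) * (k - (r / 2 : ℕ)) with hf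
  have hterm : ∀ Λ ∈ {Λ : V | G.dist Λ Λ₁ ≤ 2 * k},
      multKR G (2 * k) Λ₁ Λ * inumKR G p m₂ Λ₂ Λ = f (G.dist Λ Λ₁) := by
    intro Λ hΛ
    rw [Set.mem_ofPred_eq] at hΛ
    have hmod := dist_mod_two_of_isTree htree Λ₁ Λ₂ Λ
    have htri := htree.connected.dist_triangle (u := Λ) (v := Λ₁) (w := Λ₂)
    have hle : G.dist Λ Λ₂ ≤ m₂ := by omega
    rcases Nat.mod_two_eq_zero_or_one (G.dist Λ Λ₁) with h | h
    · have h₂ : G.dist Λ Λ₂ % 2 = m₂ % 2 := by omega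
      simp only [multKR, inumKR, hf, hΛ, hle, h, h₂, if_true, Nat.mul_mod_right, mul_one]
      omega
    · have h₂ : G.dist Λ Λ₂ % 2 ≠ m₂ % 2 := by omega
      simp only [multKR, inumKR, hf, hΛ, hle, h, h₂, if_true, if_false, Nat.mul_mod_right,
        one_ne_zero]
      rw [mul_comm]
      congr 1
      omega
  rw [finsum_mem_congr rfl hterm, finsum_mem_ball_of_isTree htree hdeg,
    sum_range_two_mul_geom (p : ℤ) k f (fun j ↦ ?_) (fun j ↦ ?_)]
  · have hgeom : ((p : ℤ) ^ (2 * k) - 1) / ((p : ℤ) - 1)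
        = ∑ r ∈ Finset.range (2 * k), (p : ℤ) ^ r :=
      Int.ediv_eq_of_eq_mul_left (by omega) (geom_sum_mul _ _).symm
    rw [hgeom]
    simp [hf, sub_eq_add_neg]
  · have h₁ : (2 * j + 1) % 2 = 1 := by omega
    have h₂ : (2 * j + 1) / 2 = j := by omega
    simp only [hf, h₁, h₂, one_ne_zero, if_false]
  · simp [hf]
end

section
/- Let m₁ ≤ m₂ be nonnegative integers and Λ₁, Λ₂ vertices of G, and set d := d(Λ₁,Λ₂). Assume d ≤ m₁ + m₂ (equivalently, the balls B(Λ₁,m₁) and B(Λ₂,m₂) intersect) and m₁ + m₂ ≡ d (mod 2). Set r := min((m₁ + m₂ − d)/2, m₁). Then there exists a unique vertex Γ with d(Λ₁,Γ) = m₁ − r and d(Λ₁,Γ) + d(Γ,Λ₂) = d (i.e., Γ lies on the geodesic from Λ₁ to Λ₂, with d(Λ₂,Γ) = d − (m₁ − r)), and for this Γ one has B(Λ₁,m₁) ∩ B(Λ₂,m₂) = B(Γ,r). -/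
open SimpleGraph

/-- A vertex on a shortest walk splits the distance between its endpoints. -/
theorem SimpleGraph.Walk.dist_add_dist_of_mem_support {V : Type*} {G : SimpleGraph V}
    (hG : G.Connected) {a b c : V} (p : G.Walk a b) (hp : p.length = G.dist a b)
    (hc : c ∈ p.support) : G.dist a c + G.dist c b = G.dist a b := by
  classical
  have hlen := congrArg Walk.length (p.take_spec hc)
  rw [Walk.length_append] at hlen
  have h₁ := dist_le (p.takeUntil c hc)
  have h₂ := dist_le (p.dropUntil c hc)
  have h₃ := hG.dist_triangle (u := a) (v := c) (w := b)
  omega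

/-- Every intermediate distance is realised by a vertex between the two given ones. -/
theorem SimpleGraph.Connected.exists_dist_eq_and_dist_add_dist {V : Type*} {G : SimpleGraph V}
    (hG : G.Connected) {a b : V} {k : ℕ} (hk : k ≤ G.dist a b) :
    ∃ c, G.dist a c = k ∧ G.dist a c + G.dist c b = G.dist a b := by
  obtain ⟨p, hp⟩ := hG.exists_walk_length_eq_dist a b
  have h := p.dist_add_dist_of_mem_support hG hp (p.getVert_mem_support k)
  refine ⟨p.getVert k, ?_, h⟩
  have h₁ := dist_le (p.take k)
  have h₂ := dist_le (p.drop k)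
  simp only [Walk.take_length, Walk.drop_length] at h₁ h₂
  omega

/-- In a tree, a vertex between `a` and `b` lies between `v` and `a` or between `v` and `b`. -/
theorem SimpleGraph.IsTree.dist_add_dist_eq_or {V : Type*} {G : SimpleGraph V}
    (hG : G.IsTree) {a b c : V} (hc : G.dist a c + G.dist c b = G.dist a b) (v : V) :
    G.dist v c + G.dist c a = G.dist v a ∨ G.dist v c + G.dist c b = G.dist v b := by
  classical
  have hconn := hG.connected
  obtain ⟨p, hp⟩ := hconn.exists_walk_length_eq_dist v a
  obtain ⟨q, hq⟩ := hconn.exists_walk_length_eq_dist v b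
  obtain ⟨s, hs⟩ := hconn.exists_walk_length_eq_dist a c
  obtain ⟨t, ht⟩ := hconn.exists_walk_length_eq_dist c b
  have hst : (s.append t).IsPath :=
    (s.append t).isPath_of_length_eq_dist (by rw [Walk.length_append]; omega)
  have heq : s.append t = (p.reverse.append q).bypass :=
    (hG.existsUnique_path a b).unique hst (Walk.bypass_isPath _)
  have hmem : c ∈ (p.reverse.append q).support :=
    Walk.support_bypass_subset_support _ (by rw [← heq]; simp [Walk.mem_support_append_iff])
  rw [Walk.mem_support_append_iff, Walk.support_reverse, List.mem_reverse] at hmem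
  exact hmem.imp (p.dist_add_dist_of_mem_support hconn hp)
    (q.dist_add_dist_of_mem_support hconn hq)

theorem statement5 {V : Type*} (G : SimpleGraph V) (htree : G.IsTree)
    (m₁ m₂ : ℕ) (hm : m₁ ≤ m₂) (Λ₁ Λ₂ : V)
    (hmeet : G.dist Λ₁ Λ₂ ≤ m₁ + m₂)
    (hpar : (m₁ + m₂) % 2 = G.dist Λ₁ Λ₂ % 2) :
    (∃! Γ : V,
        G.dist Λ₁ Γ = m₁ - min ((m₁ + m₂ - G.dist Λ₁ Λ₂) / 2) m₁ ∧
        G.dist Λ₁ Γ + G.dist Γ Λ₂ = G.dist Λ₁ Λ₂) ∧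
    (∀ Γ : V,
        (G.dist Λ₁ Γ = m₁ - min ((m₁ + m₂ - G.dist Λ₁ Λ₂) / 2) m₁ ∧
          G.dist Λ₁ Γ + G.dist Γ Λ₂ = G.dist Λ₁ Λ₂) →
        {v : V | G.dist v Λ₁ ≤ m₁} ∩ {v : V | G.dist v Λ₂ ≤ m₂}
          = {v : V | G.dist v Γ ≤ min ((m₁ + m₂ - G.dist Λ₁ Λ₂) / 2) m₁}) := by
  have hconn := htree.connected
  obtain ⟨c, hc₁, hc₂⟩ := hconn.exists_dist_eq_and_dist_add_dist (a := Λ₁) (b := Λ₂)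
    (k := m₁ - min ((m₁ + m₂ - G.dist Λ₁ Λ₂) / 2) m₁) (by omega)
  refine ⟨⟨c, ⟨hc₁, hc₂⟩, ?_⟩, ?_⟩
  · rintro c' ⟨h₁, h₂⟩
    rw [← hconn.dist_eq_zero_iff]
    have := htree.dist_add_dist_eq_or hc₂ c'
    rw [G.dist_comm (u := c) (v := Λ₁), G.dist_comm (u := c') (v := Λ₁)] at this
    omega
  · rintro Γ ⟨h₁, h₂⟩
    ext v
    simp only [Set.mem_inter_iff, Set.mem_ofPred_eq]
    have hor := htree.dist_add_dist_eq_or h₂ v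
    have ht₁ := hconn.dist_triangle (u := v) (v := Γ) (w := Λ₁)
    have ht₂ := hconn.dist_triangle (u := v) (v := Γ) (w := Λ₂)
    rw [G.dist_comm (u := Γ) (v := Λ₁)] at hor ht₁
    by_cases hΓ : G.dist Λ₁ Γ = 0
    · obtain rfl := hconn.dist_eq_zero_iff.mp hΓ
      omega
    · omega
end

section
/- Let α ≥ β ≥ 0 and c ≥ d ≥ 0 be integers with c ≤ α + 1, d ≤ β + 1, and c > β + 1. Then for every integer j ≥ 1: I_j((c,d),(α,β)) = −p³ if 1 ≤ j < d; = p² − p³ if j = d and d < β + 1; = p² if d + 1 ≤ j < β + 1; = −p if β + 1 ≤ j < c (this includes the case d = β + 1); = 1 − p if j = c and c < α + 1; = 1 if j = c = α + 1; and = 1 if j > c. -/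
/-- The symbol `[u,v]` of Hironaka, for integers `u ≥ v ≥ 0`. -/
noncomputable def bsym (p u v : ℕ) : ℚ :=
  (∏ i ∈ Finset.Icc 1 u, (1 - (-(p : ℚ))⁻¹ ^ i)) /
    ((∏ i ∈ Finset.Icc 1 v, (1 - (-(p : ℚ))⁻¹ ^ i)) *
      (∏ i ∈ Finset.Icc 1 (u - v), (1 - (-(p : ℚ))⁻¹ ^ i)))

/-- For a pair `a = (a₁, a₂)`, the quantity `a'_i = #{j ∈ {1,2} : a_j ≥ i}`. -/
def dualCt (a : ℕ × ℕ) (i : ℕ) : ℕ :=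
  (if i ≤ a.1 then 1 else 0) + (if i ≤ a.2 then 1 else 0)

/-- Hironaka's local factor `I_j(μ, λ)`, for pairs `μ = (c,d)`, `λ = (λ₁,λ₂)`. -/
noncomputable def hirI (p : ℕ) (μ lam : ℕ × ℕ) (j : ℕ) : ℚ :=
  ∑ i ∈ Finset.Icc (dualCt μ (j + 1))
      (min (dualCt (lam.1 + 1, lam.2 + 1) (j + 1)) (dualCt μ j)),
    (-(p : ℚ)) ^ (i * (2 * dualCt (lam.1 + 1, lam.2 + 1) (j + 1) + 1 - i) / 2) *
      bsym p (dualCt (lam.1 + 1, lam.2 + 1) (j + 1) - dualCt μ (j + 1))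
        (dualCt (lam.1 + 1, lam.2 + 1) (j + 1) - i) *
      bsym p (dualCt (lam.1 + 1, lam.2 + 1) j - i)
        (dualCt (lam.1 + 1, lam.2 + 1) j - dualCt μ j)

theorem prod_Icc_one_sub_neg_inv_pow_ne_zero {p : ℕ} (hp : 1 < p) (n : ℕ) :
    ∏ i ∈ Finset.Icc 1 n, (1 - (-(p : ℚ))⁻¹ ^ i) ≠ 0 := by
  refine Finset.prod_ne_zero_iff.mpr fun i hi h => ?_
  have hi' : i ≠ 0 := by have := (Finset.mem_Icc.mp hi).1; omega
  have hp' : (1 : ℚ) < p := by exact_mod_cast hp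
  have h1 : |(-(p : ℚ))⁻¹ ^ i| = 1 := by rw [← sub_eq_zero.mp h, abs_one]
  rw [abs_pow, abs_inv, abs_neg, Nat.abs_cast] at h1
  exact (pow_lt_one₀ (by positivity) (inv_lt_one_of_one_lt₀ hp') hi').ne h1

theorem bsym_self {p : ℕ} (hp : 1 < p) (n : ℕ) : bsym p n n = 1 := by
  simpa [bsym] using prod_Icc_one_sub_neg_inv_pow_ne_zero hp n

theorem bsym_zero_right {p : ℕ} (hp : 1 < p) (n : ℕ) : bsym p n 0 = 1 := by
  simpa [bsym] using prod_Icc_one_sub_neg_inv_pow_ne_zero hp n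

theorem dualCt_eq_two {a : ℕ × ℕ} {i : ℕ} (h₁ : i ≤ a.1) (h₂ : i ≤ a.2) : dualCt a i = 2 := by
  simp [dualCt, h₁, h₂]

theorem dualCt_eq_one {a : ℕ × ℕ} {i : ℕ} (h₁ : i ≤ a.1) (h₂ : a.2 < i) : dualCt a i = 1 := by
  simp [dualCt, h₁, h₂]

theorem dualCt_eq_zero {a : ℕ × ℕ} {i : ℕ} (h₁ : a.1 < i) (h₂ : a.2 < i) : dualCt a i = 0 := by
  simp [dualCt, h₁, h₂]

theorem statement7 (p : ℕ) (hp : p.Prime) (hodd : Odd p)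
    (α β c d : ℕ) (hβα : β ≤ α) (hdc : d ≤ c) (hcα : c ≤ α + 1) (hdβ : d ≤ β + 1)
    (hcβ : β + 1 < c) (j : ℕ) (hj : 1 ≤ j) :
    (j < d → hirI p (c, d) (α, β) j = -(p : ℚ) ^ 3) ∧
    (j = d ∧ d < β + 1 → hirI p (c, d) (α, β) j = (p : ℚ) ^ 2 - (p : ℚ) ^ 3) ∧
    (d + 1 ≤ j ∧ j < β + 1 → hirI p (c, d) (α, β) j = (p : ℚ) ^ 2) ∧
    (β + 1 ≤ j ∧ j < c → hirI p (c, d) (α, β) j = -(p : ℚ)) ∧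
    (j = c ∧ c < α + 1 → hirI p (c, d) (α, β) j = 1 - (p : ℚ)) ∧
    (j = c ∧ c = α + 1 → hirI p (c, d) (α, β) j = 1) ∧
    (c < j → hirI p (c, d) (α, β) j = 1) := by
  have hp1 := hp.one_lt
  have hself := bsym_self hp1
  have hzero := bsym_zero_right hp1
  have h01 : Finset.Icc 0 1 = {0, 1} := rfl
  have h12 : Finset.Icc 1 2 = {1, 2} := rfl
  refine ⟨fun h => ?_, fun h => ?_, fun h => ?_, fun h => ?_, fun h => ?_, fun h => ?_,
    fun h => ?_⟩
  · rw [hirI, dualCt_eq_two (a := (c, d)) (i := j + 1) (by grind) (by grind),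
      dualCt_eq_two (a := (c, d)) (i := j) (by grind) (by grind),
      dualCt_eq_two (i := j + 1) (by grind) (by grind),
      dualCt_eq_two (i := j) (by grind) (by grind)]
    simp [hself]
    ring
  · rw [hirI, dualCt_eq_one (a := (c, d)) (i := j + 1) (by grind) (by grind),
      dualCt_eq_two (a := (c, d)) (i := j) (by grind) (by grind),
      dualCt_eq_two (i := j + 1) (by grind) (by grind),
      dualCt_eq_two (i := j) (by grind) (by grind)]
    simp [hself, hzero, h12]
    ring
  · rw [hirI, dualCt_eq_one (a := (c, d)) (i := j + 1) (by grind) (by grind),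
      dualCt_eq_one (a := (c, d)) (i := j) (by grind) (by grind),
      dualCt_eq_two (i := j + 1) (by grind) (by grind),
      dualCt_eq_two (i := j) (by grind) (by grind)]
    simp [hself]
  · rw [hirI, dualCt_eq_one (a := (c, d)) (i := j + 1) (by grind) (by grind),
      dualCt_eq_one (i := j + 1) (by grind) (by grind)]
    rcases h.1.eq_or_lt with rfl | hlt
    · rw [dualCt_eq_two (a := (α + 1, β + 1)) (by grind) (by grind)]
      rcases hdβ.eq_or_lt with rfl | hd
      · rw [dualCt_eq_two (by grind) (by grind)]
        simp [hself, hzero]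
      · rw [dualCt_eq_one (by grind) (by grind)]
        simp [hself]
    · rw [dualCt_eq_one (a := (c, d)) (by grind) (by grind),
        dualCt_eq_one (by grind) (by grind)]
      simp [hself]
  · rw [hirI, dualCt_eq_zero (a := (c, d)) (i := j + 1) (by grind) (by grind),
      dualCt_eq_one (a := (c, d)) (i := j) (by grind) (by grind),
      dualCt_eq_one (i := j + 1) (by grind) (by grind),
      dualCt_eq_one (i := j) (by grind) (by grind)]
    simp [hself, hzero, h01]
    ring
  · rw [hirI, dualCt_eq_zero (a := (c, d)) (i := j + 1) (by grind) (by grind),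
      dualCt_eq_one (a := (c, d)) (i := j) (by grind) (by grind),
      dualCt_eq_zero (i := j + 1) (by grind) (by grind),
      dualCt_eq_one (i := j) (by grind) (by grind)]
    simp [hself, hzero]
  · rw [hirI, dualCt_eq_zero (a := (c, d)) (i := j + 1) (by grind) (by grind),
      dualCt_eq_zero (a := (c, d)) (i := j) (by grind) (by grind)]
    simp [hself]
end

section
/- Let α ≥ β ≥ 0 and d ≥ 0 be integers with d ≤ β. Then for every integer j ≥ 1: I_j((d,d),(α,β)) = −p³ if 1 ≤ j < d; = (1 + p²)(1 − p) if j = d; and = 1 if j > d. (When d = 0, I_j((0,0),(α,β)) = 1 for all j ≥ 1.) -/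
theorem one_sub_neg_inv_pow_ne_zero {p : ℕ} (hp : 1 < p) {i : ℕ} (hi : i ≠ 0) :
    1 - (-(p : ℚ))⁻¹ ^ i ≠ 0 := by
  have hp' : (1 : ℚ) < p := by exact_mod_cast hp
  intro h
  have habs : |(-(p : ℚ))⁻¹| ^ i < 1 := by
    refine pow_lt_one₀ (abs_nonneg _) ?_ hi
    rw [abs_inv, abs_neg, abs_of_pos (by linarith)]
    exact inv_lt_one_of_one_lt₀ hp'
  rw [← abs_pow, ← sub_eq_zero.mp h] at habs
  simp at habs

theorem prod_one_sub_neg_inv_pow_ne_zero {p : ℕ} (hp : 1 < p) (n : ℕ) :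
    (∏ i ∈ Finset.Icc 1 n, (1 - (-(p : ℚ))⁻¹ ^ i)) ≠ 0 := by
  refine Finset.prod_ne_zero_iff.mpr fun i hi => ?_
  exact one_sub_neg_inv_pow_ne_zero hp (by grind)

theorem bsym_two_one {p : ℕ} (hp : 1 < p) : bsym p 2 1 = 1 - (p : ℚ)⁻¹ := by
  have h := one_sub_neg_inv_pow_ne_zero hp one_ne_zero
  rw [pow_one] at h
  simp only [bsym, Finset.prod_Icc_succ_top (show 1 ≤ 1 + 1 by norm_num), Finset.Icc_self,
    Finset.prod_singleton, pow_one, Nat.add_one_sub_one]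
  rw [div_eq_iff (mul_ne_zero h h), inv_neg]
  ring

theorem dualCt_of_le {a b i : ℕ} (ha : i ≤ a) (hb : i ≤ b) : dualCt (a, b) i = 2 := by
  simp [dualCt, ha, hb]

theorem dualCt_of_lt {a b i : ℕ} (ha : a < i) (hb : b < i) : dualCt (a, b) i = 0 := by
  simp [dualCt, ha, hb]

theorem statement9 (p : ℕ) (hp : p.Prime) (hodd : Odd p)
    (α β d : ℕ) (hβα : β ≤ α) (hdβ : d ≤ β)
    (j : ℕ) (hj : 1 ≤ j) :
    (j < d → hirI p (d, d) (α, β) j = -(p : ℚ) ^ 3) ∧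
    (j = d → hirI p (d, d) (α, β) j = (1 + (p : ℚ) ^ 2) * (1 - (p : ℚ))) ∧
    (d < j → hirI p (d, d) (α, β) j = 1) := by
  have hp1 := hp.one_lt
  have hp0 : (p : ℚ) ≠ 0 := by exact_mod_cast hp.ne_zero
  refine ⟨fun h => ?_, fun h => ?_, fun h => ?_⟩
  · simp only [hirI]
    rw [dualCt_of_le (a := d) (i := j + 1) (by lia) (by lia),
      dualCt_of_le (a := d) (i := j) (by lia) (by lia),
      dualCt_of_le (a := α + 1) (i := j + 1) (by lia) (by lia),
      dualCt_of_le (a := α + 1) (i := j) (by lia) (by lia)]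
    simp [bsym_self hp1, Odd.neg_pow (show Odd 3 by decide)]
  · simp only [hirI]
    rw [dualCt_of_lt (a := d) (i := j + 1) (by lia) (by lia),
      dualCt_of_le (a := d) (i := j) (by lia) (by lia),
      dualCt_of_le (a := α + 1) (i := j + 1) (by lia) (by lia),
      dualCt_of_le (a := α + 1) (i := j) (by lia) (by lia)]
    rw [min_self, show Finset.Icc 0 2 = {0, 1, 2} by decide]
    simp [bsym_self hp1, bsym_zero_right hp1, bsym_two_one hp1]
    field_simp
    ring
  · simp only [hirI]
    rw [dualCt_of_lt (a := d) (i := j + 1) (by lia) (by lia),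
      dualCt_of_lt (a := d) (i := j) (by lia) (by lia)]
    simp [bsym_self hp1]
end
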